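/- Let G(p) be a tensegrity framework in ℝ^d: a finite graph G on vertices 1, …, n, each edge labeled cable, strut, or bar, together with a configuration p = (p₁, …, pₙ), pᵢ ∈ ℝ^d, with pᵢ ≠ pⱼ for edges {i,j}. Then G(p) is infinitesimally rigid as a tensegrity if and only if the underlying bar framework (all edges replaced by bars) is infinitesimally rigid and G(p) admits a strict proper equilibrium stress. -/

import Mathlib

noncomputable section

open scoped RealInnerProductSpace

namespace IsostaticPaper

/-- Points of the Euclidean plane `ℝ²`. -/
abbrev Pt : Type := EuclideanSpace ℝ (Fin 2)

/-- The point `(x, y) ∈ ℝ²`. -/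
def vec (x y : ℝ) : Pt := (WithLp.equiv 2 (Fin 2 → ℝ)).symm ![x, y]

/-- The lattice `Λ ⊆ ℝ²` spanned over `ℤ` by the two vectors `v₁, v₂`. -/
def lat (v₁ v₂ : Pt) : Set Pt :=
  {l : Pt | ∃ z₁ z₂ : ℤ, l = (z₁ : ℝ) • v₁ + (z₂ : ℝ) • v₂}

/-- `(p, r)` is a packing of disks in the flat torus `ℝ²/Λ`:
all radii are positive and `‖pᵢ - pⱼ + λ‖ ≥ rᵢ + rⱼ` for all `i, j` and all
`λ ∈ Λ` with `(j, λ) ≠ (i, 0)`. -/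
def IsPacking (Λ : Set Pt) {ι : Type} (p : ι → Pt) (r : ι → ℝ) : Prop :=
  (∀ i, 0 < r i) ∧
  ∀ i j : ι, ∀ l ∈ Λ, ¬(j = i ∧ l = 0) → r i + r j ≤ ‖p i - p j + l‖

/-- A contact of the packing `(p, r)` is a triple `(i, j, λ)`, `λ ∈ Λ`,
`(j, λ) ≠ (i, 0)`, with `‖pᵢ - pⱼ + λ‖ = rᵢ + rⱼ`. -/
def IsContact (Λ : Set Pt) {ι : Type} (p : ι → Pt) (r : ι → ℝ) (c : ι × ι × Pt) : Prop :=
  c.2.2 ∈ Λ ∧ ¬(c.2.1 = c.1 ∧ c.2.2 = 0) ∧ ‖p c.1 - p c.2.1 + c.2.2‖ = r c.1 + r c.2.1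

/-- A packing `(p, r)` in `ℝ²/Λ` is collectively jammed if every continuous path of
configurations `t ↦ q t`, `t ∈ [0,1]`, starting at `p` and keeping `(q t, r)` a packing,
moves `p` only by translations. -/
def CollectivelyJammed (Λ : Set Pt) {ι : Type} (p : ι → Pt) (r : ι → ℝ) : Prop :=
  ∀ q : ℝ → ι → Pt,
    (∀ i, ContinuousOn (fun t => q t i) (Set.Icc 0 1)) →
    q 0 = p →
    (∀ t ∈ Set.Icc (0:ℝ) 1, IsPacking Λ (q t) r) →
    ∀ t ∈ Set.Icc (0:ℝ) 1, ∀ i j, q t i - p i = q t j - p j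

/-- Euclidean distance between two configurations of centers. -/
def pdist {ι : Type} [Fintype ι] (p q : ι → Pt) : ℝ :=
  Real.sqrt (∑ i, ‖p i - q i‖ ^ 2)

/-- Euclidean distance between two vectors of radii. -/
def rdist {ι : Type} [Fintype ι] (r s : ι → ℝ) : ℝ :=
  Real.sqrt (∑ i, (r i - s i) ^ 2)

/-- Determinant of the pair of lattice basis vectors `v₁, v₂`. -/
def det2 (v₁ v₂ : Pt) : ℝ := v₁ 0 * v₂ 1 - v₁ 1 * v₂ 0

/-- Density of a packing with radii `r` in the torus with lattice basis `v₁, v₂`. -/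
def density (v₁ v₂ : Pt) {ι : Type} [Fintype ι] (r : ι → ℝ) : ℝ :=
  Real.pi * (∑ i, r i ^ 2) / |det2 v₁ v₂|

/-- `(p, r)` is locally maximally dense in the torus with lattice basis `v₁, v₂`:
it is a packing and, for some `ε > 0`, every nearby packing whose radii are a positive
scalar multiple of `r` has density at most that of `(p, r)`. -/
def LocallyMaxDense (v₁ v₂ : Pt) {ι : Type} [Fintype ι] (p : ι → Pt) (r : ι → ℝ) : Prop :=
  IsPacking (lat v₁ v₂) p r ∧
  ∃ ε > 0, ∀ (q : ι → Pt) (t : ℝ), 0 < t →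
    IsPacking (lat v₁ v₂) q (fun i => t * r i) →
    pdist q p < ε → rdist (fun i => t * r i) r < ε →
    density v₁ v₂ (fun i => t * r i) ≤ density v₁ v₂ r

/-- An infinitesimal flex `p'` of the packing: `(pᵢ - pⱼ + λ) · (p'ᵢ - p'ⱼ) ≥ 0`
for every contact `(i, j, λ)`. -/
def IsInfFlex (Λ : Set Pt) {ι : Type} (p : ι → Pt) (r : ι → ℝ) (p' : ι → Pt) : Prop :=
  ∀ c : ι × ι × Pt, IsContact Λ p r c →
    0 ≤ ⟪p c.1 - p c.2.1 + c.2.2, p' c.1 - p' c.2.1⟫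

/-- The packing is infinitesimally rigid if every infinitesimal flex is trivial
(all `p'ᵢ` equal). -/
def InfinitesimallyRigid (Λ : Set Pt) {ι : Type} (p : ι → Pt) (r : ι → ℝ) : Prop :=
  ∀ p' : ι → Pt, IsInfFlex Λ p r p' → ∀ i j, p' i = p' j

/-- The space of equilibrium stresses of a packing whose (finite) set of ordered
contact triples is `K`: scalars on contacts with `ω(i,j,λ) = ω(j,i,-λ)`, vanishing off
`K`, in equilibrium at every vertex. -/
def stressSpace {n : ℕ} (K : Finset (Fin n × Fin n × Pt)) (p : Fin n → Pt) :
    Submodule ℝ ((Fin n × Fin n × Pt) → ℝ) where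
  carrier := {ω | (∀ c ∉ K, ω c = 0) ∧
    (∀ i j l, ω (i, j, l) = ω (j, i, -l)) ∧
    (∀ i, ∑ c ∈ K.filter (fun c => c.1 = i), ω c • (p c.1 - p c.2.1 + c.2.2) = 0)}
  zero_mem' := ⟨fun _ _ => rfl, fun _ _ _ => rfl, fun i => by simp⟩
  add_mem' := by
    rintro ω₁ ω₂ ⟨h1, h2, h3⟩ ⟨g1, g2, g3⟩
    refine ⟨fun c hc => ?_, fun i j l => ?_, fun i => ?_⟩
    · simp [h1 c hc, g1 c hc]
    · simp [h2 i j l, g2 i j l]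
    · simp only [Pi.add_apply, add_smul, Finset.sum_add_distrib, h3 i, g3 i, add_zero]
  smul_mem' := by
    rintro t ω ⟨h1, h2, h3⟩
    refine ⟨fun c hc => ?_, fun i j l => ?_, fun i => ?_⟩
    · simp [h1 c hc]
    · simp [h2 i j l]
    · simp only [Pi.smul_apply, smul_assoc, ← Finset.smul_sum, h3 i, smul_zero]


/-- Labels for the edges of a tensegrity. -/
inductive EdgeLabel : Type
  | cable : EdgeLabel
  | strut : EdgeLabel
  | bar : EdgeLabel
deriving DecidableEq

/-- A tensegrity framework in `ℝ^d`: a finite graph on vertices `1, …, n` whose edges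
are labeled cable, strut or bar, together with a configuration `p` with distinct
endpoints on every edge. -/
structure Tensegrity (d n : ℕ) where
  p : Fin n → EuclideanSpace ℝ (Fin d)
  label : Fin n → Fin n → Option EdgeLabel
  symm : ∀ i j, label i j = label j i
  loopless : ∀ i, label i i = none
  nondeg : ∀ i j, (label i j).isSome → p i ≠ p j

/-- An infinitesimal flex of the tensegrity: `(pᵢ - pⱼ)·(p'ᵢ - p'ⱼ)` is `≤ 0` on
cables, `≥ 0` on struts and `= 0` on bars. -/
def IsTensegrityFlex {d n : ℕ} (T : Tensegrity d n)
    (p' : Fin n → EuclideanSpace ℝ (Fin d)) : Prop :=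
  ∀ i j,
    (T.label i j = some EdgeLabel.cable → ⟪T.p i - T.p j, p' i - p' j⟫ ≤ 0) ∧
    (T.label i j = some EdgeLabel.strut → 0 ≤ ⟪T.p i - T.p j, p' i - p' j⟫) ∧
    (T.label i j = some EdgeLabel.bar → ⟪T.p i - T.p j, p' i - p' j⟫ = 0)

/-- A trivial infinitesimal flex: `p'ᵢ = S pᵢ + t` for a skew-symmetric matrix `S`
and a translation `t`. -/
def IsTrivialFlex {d n : ℕ} (p p' : Fin n → EuclideanSpace ℝ (Fin d)) : Prop :=
  ∃ S : Matrix (Fin d) (Fin d) ℝ, Matrix.transpose S = -S ∧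
    ∃ t : EuclideanSpace ℝ (Fin d), ∀ i k, p' i k = (∑ m, S k m * p i m) + t k

/-- The tensegrity is infinitesimally rigid: every infinitesimal flex is trivial. -/
def TensegrityInfRigid {d n : ℕ} (T : Tensegrity d n) : Prop :=
  ∀ p', IsTensegrityFlex T p' → IsTrivialFlex T.p p'

/-- The underlying bar framework (all edges replaced by bars) is infinitesimally
rigid: every `p'` with `(pᵢ - pⱼ)·(p'ᵢ - p'ⱼ) = 0` on all edges is trivial. -/
def BarFrameworkInfRigid {d n : ℕ} (T : Tensegrity d n) : Prop :=
  ∀ p' : Fin n → EuclideanSpace ℝ (Fin d),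
    (∀ i j, (T.label i j).isSome → ⟪T.p i - T.p j, p' i - p' j⟫ = 0) →
    IsTrivialFlex T.p p'

/-- An equilibrium stress of the tensegrity: symmetric scalars on the edges, zero on
non-edges, in equilibrium at every vertex. -/
def IsEqStress {d n : ℕ} (T : Tensegrity d n) (ω : Fin n → Fin n → ℝ) : Prop :=
  (∀ i j, ω i j = ω j i) ∧
  (∀ i j, T.label i j = none → ω i j = 0) ∧
  (∀ i, ∑ j, ω i j • (T.p i - T.p j) = 0)

/-- A strict proper stress: positive on every cable, negative on every strut. -/
def IsStrictProper {d n : ℕ} (T : Tensegrity d n) (ω : Fin n → Fin n → ℝ) : Prop :=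
  (∀ i j, T.label i j = some EdgeLabel.cable → 0 < ω i j) ∧
  (∀ i j, T.label i j = some EdgeLabel.strut → ω i j < 0)

/-- Stiemke's transposition theorem: if no `v` makes all `L v i` nonnegative without making
them all zero, then some strictly positive combination of the functionals vanishes. -/
lemma exists_pos_sum_mul_eq_zero {ι V : Type*} [Fintype ι] [AddCommGroup V] [Module ℝ V]
    (L : V →ₗ[ℝ] ι → ℝ) (hL : ∀ v, (∀ i, 0 ≤ L v i) → ∀ i, L v i = 0) :
    ∃ c : ι → ℝ, (∀ i, 0 < c i) ∧ ∀ v, ∑ i, c i * L v i = 0 := by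
  classical
  have disj : Disjoint (stdSimplex ℝ ι) (LinearMap.range L : Set (ι → ℝ)) := by
    rw [Set.disjoint_left]
    rintro _ ⟨h0, h1⟩ ⟨v, rfl⟩
    simp [hL v h0] at h1
  obtain ⟨f, u, w, hu, huw, hw⟩ := geometric_hahn_banach_compact_closed
    (convex_stdSimplex ℝ ι) (isCompact_stdSimplex ℝ ι) (LinearMap.range L).convex
    (Submodule.closed_of_finiteDimensional _) disj
  have hw0 : w < 0 := by simpa using hw 0 (LinearMap.range L).zero_mem
  have hzero : ∀ v, f (L v) = 0 := by
    intro v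
    by_contra hv
    have h := hw (L ((w / f (L v)) • v)) ⟨_, rfl⟩
    rw [map_smul, map_smul, smul_eq_mul, div_mul_cancel₀ _ hv] at h
    exact lt_irrefl _ h
  refine ⟨fun i => -f (Pi.single i 1), fun i => ?_, fun v => ?_⟩
  · linarith [hu _ (single_mem_stdSimplex ℝ i)]
  · have h := hzero v
    rw [pi_eq_sum_univ' (L v), map_sum] at h
    simp only [map_smul, smul_eq_mul] at h
    rw [← neg_eq_zero, ← Finset.sum_neg_distrib, ← h]
    refine Finset.sum_congr rfl fun i _ => ?_
    have hs : (Pi.single i 1 : ι → ℝ) = fun j => if i = j then 1 else 0 := by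
      ext j
      simp [Pi.single_apply, eq_comm]
    simp only [hs]
    ring

/-- The virtual work of the edge coefficients `σ` equals the work of the resulting
vertex forces. -/
lemma sum_mul_inner_sub {E ι : Type*} [NormedAddCommGroup E] [InnerProductSpace ℝ E]
    [Fintype ι] (σ : ι → ι → ℝ) (p v : ι → E) :
    ∑ i, ∑ j, σ i j * ⟪p i - p j, v i - v j⟫ =
      ∑ i, ⟪∑ j, (σ i j + σ j i) • (p i - p j), v i⟫ := by
  have h : ∑ i, ∑ j, σ i j * ⟪p i - p j, v j⟫ = ∑ i, ∑ j, σ j i * ⟪p j - p i, v i⟫ :=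
    Finset.sum_comm
  simp only [inner_sub_right, mul_sub, Finset.sum_sub_distrib, h]
  simp only [← Finset.sum_sub_distrib, sum_inner, real_inner_smul_left]
  refine Finset.sum_congr rfl fun i _ => Finset.sum_congr rfl fun j _ => ?_
  rw [← neg_sub (p i) (p j), inner_neg_left]
  ring

lemma IsTrivialFlex.inner_eq_zero {d n : ℕ} {p p' : Fin n → EuclideanSpace ℝ (Fin d)}
    (h : IsTrivialFlex p p') (i j : Fin n) : ⟪p i - p j, p' i - p' j⟫ = 0 := by
  obtain ⟨S, hS, t, ht⟩ := h
  have hS' : ∀ k m, S m k = -S k m := fun k m => congrFun (congrFun hS k) m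
  have key : ⟪p i - p j, p' i - p' j⟫ =
      ∑ k, ∑ m, S k m * ((p i - p j) m * (p i - p j) k) := by
    simp only [PiLp.inner_apply, PiLp.sub_apply, ht, RCLike.inner_apply, conj_trivial]
    refine Finset.sum_congr rfl fun k _ => ?_
    rw [add_sub_add_right_eq_sub, ← Finset.sum_sub_distrib, Finset.sum_mul]
    exact Finset.sum_congr rfl fun m _ => by ring
  have hneg : ∑ k, ∑ m, S k m * ((p i - p j) m * (p i - p j) k) =
      -∑ k, ∑ m, S k m * ((p i - p j) m * (p i - p j) k) := by
    conv_lhs => rw [Finset.sum_comm]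
    simp only [← Finset.sum_neg_distrib]
    refine Finset.sum_congr rfl fun k _ => Finset.sum_congr rfl fun m _ => ?_
    rw [hS' k m]
    ring
  linarith

/-- Signs turning the tensegrity constraints into the inequalities `0 ≤ sign * ⟪·, ·⟫`;
a bar contributes one inequality for each value of the Boolean. -/
def edgeSign : Option EdgeLabel → Bool → ℝ
  | none, _ => 0
  | some EdgeLabel.cable, _ => -1
  | some EdgeLabel.strut, _ => 1
  | some EdgeLabel.bar, true => 1
  | some EdgeLabel.bar, false => -1

/-- The signed strain of each edge as a linear function of the velocities. -/
def signedStrain {d n : ℕ} (T : Tensegrity d n) :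
    (Fin n → EuclideanSpace ℝ (Fin d)) →ₗ[ℝ] (Fin n × Fin n × Bool) → ℝ where
  toFun v e := edgeSign (T.label e.1 e.2.1) e.2.2 * ⟪T.p e.1 - T.p e.2.1, v e.1 - v e.2.1⟫
  map_add' v w := by
    ext e
    simp only [Pi.add_apply, add_sub_add_comm, inner_add_right, mul_add]
  map_smul' c v := by
    ext e
    simp only [Pi.smul_apply, ← smul_sub, real_inner_smul_right, RingHom.id_apply, smul_eq_mul]
    ring

lemma isTensegrityFlex_of_signedStrain_nonneg {d n : ℕ} {T : Tensegrity d n}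
    {v : Fin n → EuclideanSpace ℝ (Fin d)} (hv : ∀ e, 0 ≤ signedStrain T v e) :
    IsTensegrityFlex T v := by
  intro i j
  have h1 := hv (i, j, true)
  have h2 := hv (i, j, false)
  simp only [signedStrain, LinearMap.coe_mk, AddHom.coe_mk] at h1 h2
  refine ⟨fun h => ?_, fun h => ?_, fun h => ?_⟩ <;>
    simp only [h, edgeSign] at h1 h2 <;> linarith

lemma TensegrityInfRigid.barFrameworkInfRigid {d n : ℕ} {T : Tensegrity d n}
    (h : TensegrityInfRigid T) : BarFrameworkInfRigid T :=
  fun p' hp' => h p' fun i j =>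
    ⟨fun hl => (hp' i j (by simp [hl])).le, fun hl => (hp' i j (by simp [hl])).ge,
      fun hl => hp' i j (by simp [hl])⟩

lemma TensegrityInfRigid.exists_stress {d n : ℕ} {T : Tensegrity d n}
    (h : TensegrityInfRigid T) : ∃ ω, IsEqStress T ω ∧ IsStrictProper T ω := by
  obtain ⟨c, hc, hsum⟩ := exists_pos_sum_mul_eq_zero (signedStrain T) fun v hv e => by
    simp [signedStrain,
      (h v (isTensegrityFlex_of_signedStrain_nonneg hv)).inner_eq_zero e.1 e.2.1]
  let σ : Fin n → Fin n → ℝ := fun i j => ∑ b, c (i, j, b) * edgeSign (T.label i j) b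
  have hσ : ∀ v : Fin n → EuclideanSpace ℝ (Fin d),
      ∑ i, ⟪∑ j, (σ i j + σ j i) • (T.p i - T.p j), v i⟫ = 0 := by
    intro v
    rw [← sum_mul_inner_sub, ← hsum v]
    simp only [Fintype.sum_prod_type, σ, Finset.sum_mul, signedStrain, LinearMap.coe_mk,
      AddHom.coe_mk, mul_assoc]
  have heq : ∀ i, ∑ j, (σ i j + σ j i) • (T.p i - T.p j) = 0 := by
    have h0 := hσ fun i => ∑ j, (σ i j + σ j i) • (T.p i - T.p j)
    rw [Finset.sum_eq_zero_iff_of_nonneg fun i _ => real_inner_self_nonneg] at h0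
    exact fun i => inner_self_eq_zero.1 (h0 i (Finset.mem_univ i))
  refine ⟨fun i j => -(σ i j + σ j i), ⟨fun i j => by ring, fun i j hl => ?_, fun i => ?_⟩,
    fun i j hl => ?_, fun i j hl => ?_⟩
  · have hl' := T.symm i j ▸ hl
    simp [σ, hl, hl', edgeSign]
  · simp only [neg_smul, Finset.sum_neg_distrib, heq i, neg_zero]
  all_goals
    have hl' := T.symm i j ▸ hl
    simp only [σ, hl, hl', edgeSign, Fintype.sum_bool]
    linarith [hc (i, j, true), hc (i, j, false), hc (j, i, true), hc (j, i, false)]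

lemma IsTensegrityFlex.inner_eq_zero_of_stress {d n : ℕ} {T : Tensegrity d n}
    {ω : Fin n → Fin n → ℝ} (hω : IsEqStress T ω) (hp : IsStrictProper T ω)
    {v : Fin n → EuclideanSpace ℝ (Fin d)} (hv : IsTensegrityFlex T v) {i j : Fin n}
    (hij : (T.label i j).isSome) : ⟪T.p i - T.p j, v i - v j⟫ = 0 := by
  obtain ⟨hsymm, hnone, heq⟩ := hω
  have hwork : ∑ i, ∑ j, ω i j * ⟪T.p i - T.p j, v i - v j⟫ = 0 := by
    rw [sum_mul_inner_sub]
    refine Finset.sum_eq_zero fun i _ => ?_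
    simp only [fun j => hsymm j i, add_smul, Finset.sum_add_distrib, heq i, add_zero,
      inner_zero_left]
  have hle : ∀ i j, ω i j * ⟪T.p i - T.p j, v i - v j⟫ ≤ 0 := by
    intro i j
    obtain ⟨hcable, hstrut, hbar⟩ := hv i j
    match hl : T.label i j with
    | none => simp [hnone i j hl]
    | some EdgeLabel.cable =>
      exact mul_nonpos_of_nonneg_of_nonpos (hp.1 i j hl).le (hcable hl)
    | some EdgeLabel.strut =>
      exact mul_nonpos_of_nonpos_of_nonneg (hp.2 i j hl).le (hstrut hl)
    | some EdgeLabel.bar => simp [hbar hl]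
  rw [Finset.sum_eq_zero_iff_of_nonpos fun i _ => Finset.sum_nonpos fun j _ => hle i j] at hwork
  have hi := hwork i (Finset.mem_univ i)
  rw [Finset.sum_eq_zero_iff_of_nonpos fun j _ => hle i j] at hi
  have hprod := hi j (Finset.mem_univ j)
  match hl : T.label i j with
  | none => simp [hl] at hij
  | some EdgeLabel.cable => exact (mul_eq_zero.1 hprod).resolve_left (hp.1 i j hl).ne'
  | some EdgeLabel.strut => exact (mul_eq_zero.1 hprod).resolve_left (hp.2 i j hl).ne
  | some EdgeLabel.bar => exact (hv i j).2.2 hl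

/-- **Theorem 3.1 (Roth–Whiteley).**  A tensegrity is infinitesimally rigid if and only
if its underlying bar framework is infinitesimally rigid and it admits a strict proper
equilibrium stress. -/
theorem roth_whiteley {d n : ℕ} (T : Tensegrity d n) :
    TensegrityInfRigid T ↔
      BarFrameworkInfRigid T ∧ ∃ ω, IsEqStress T ω ∧ IsStrictProper T ω := by
  constructor
  · exact fun h => ⟨h.barFrameworkInfRigid, h.exists_stress⟩
  · rintro ⟨hbar, ω, hω, hp⟩ v hv
    exact hbar v fun i j hij => hv.inner_eq_zero_of_stress hω hp hij

end IsostaticPaper
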